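/- arXiv:1511.06208 — 2 statements merged into one kernel-verified Lean document; each statement's English description precedes it below -/
import Mathlib

section
/- Under the Gaussian mixture model q(r) = Σ_{j=1}^n a_j g(r; θ_j, Σ_j) with Σ a_j = 1, the MGC kernel has the closed form k_ε(x,y) = Σ_{j=1}^n a_j g(x; θ_j, (ε/2)I + Σ_j) g(y; c_j(x), D_j), where D_j = (ε⁻¹I + (εI + 4Σ_j)⁻¹)⁻¹ and c_j(x) = D_j(ε⁻¹x + (εI + 4Σ_j)⁻¹(2θ_j − x)). -/
open Matrix MeasureTheory

/-- Normalized Gaussian density on ℝ^m: `g(r; θ, Σ)`. -/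
noncomputable def gaussianDensity {m : ℕ} (θ : Fin m → ℝ)
    (S : Matrix (Fin m) (Fin m) ℝ) (r : Fin m → ℝ) : ℝ :=
  (2 * Real.pi) ^ (-(m : ℝ) / 2) * S.det ^ (-(1 : ℝ) / 2) *
    Real.exp (-(1 / 2) * ((r - θ) ⬝ᵥ (S⁻¹ *ᵥ (r - θ))))

/-- The MGC kernel for a Gaussian mixture measure
`q(r) = ∑ j, a j * g(r; θ j, S j)`. -/
noncomputable def mgcKernel {m : ℕ} (ε : ℝ) {n : ℕ} (a : Fin n → ℝ)
    (θ : Fin n → Fin m → ℝ) (S : Fin n → Matrix (Fin m) (Fin m) ℝ)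
    (x y : Fin m → ℝ) : ℝ :=
  ∫ r : Fin m → ℝ,
    gaussianDensity x ((ε / 2) • (1 : Matrix (Fin m) (Fin m) ℝ)) r *
      gaussianDensity y ((ε / 2) • (1 : Matrix (Fin m) (Fin m) ℝ)) r *
      (∑ j, a j * gaussianDensity (θ j) (S j) r)

/-- `D_j = (ε⁻¹ I + (ε I + 4 Σ_j)⁻¹)⁻¹`. -/
noncomputable def Dmat {m : ℕ} (ε : ℝ) (S : Matrix (Fin m) (Fin m) ℝ) :
    Matrix (Fin m) (Fin m) ℝ :=
  (ε⁻¹ • (1 : Matrix (Fin m) (Fin m) ℝ) +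
    (ε • (1 : Matrix (Fin m) (Fin m) ℝ) + (4 : ℝ) • S)⁻¹)⁻¹

/-- `c_j(x) = D_j (ε⁻¹ x + (ε I + 4 Σ_j)⁻¹(2 θ_j − x))`. -/
noncomputable def cvec {m : ℕ} (ε : ℝ) (S : Matrix (Fin m) (Fin m) ℝ)
    (θ x : Fin m → ℝ) : Fin m → ℝ :=
  Dmat ε S *ᵥ
    (ε⁻¹ • x +
      (ε • (1 : Matrix (Fin m) (Fin m) ℝ) + (4 : ℝ) • S)⁻¹ *ᵥ ((2 : ℝ) • θ - x))


noncomputable def g1 (t s r : ℝ) : ℝ :=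
  (2 * Real.pi) ^ (-(1 : ℝ) / 2) * s ^ (-(1 : ℝ) / 2) * Real.exp (-(1 / 2) * ((r - t) * (s⁻¹ * (r - t))))

lemma g1_pos (t s r : ℝ) (hs : 0 < s) : 0 < g1 t s r := by
  unfold g1; positivity

lemma rpow_neg_half (s : ℝ) (hs : 0 < s) : s ^ (-(1 : ℝ) / 2) = (√s)⁻¹ := by
  rw [Real.sqrt_eq_rpow, ← Real.rpow_neg hs.le]; norm_num

lemma int_gauss (A μ : ℝ) : ∫ r : ℝ, Real.exp (-(A / 2) * (r - μ) ^ 2) = √(Real.pi / (A / 2)) := by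
  rw [integral_sub_right_eq_self (fun r => Real.exp (-(A / 2) * r ^ 2)) μ, integral_gaussian]

lemma one_dim (ε s x y t : ℝ) (hε : 0 < ε) (hs : 0 < s) :
    ∫ r : ℝ, g1 x (ε / 2) r * g1 y (ε / 2) r * g1 t s r =
      g1 t (ε / 2 + s) x *
      g1 ((ε⁻¹ + (ε + 4 * s)⁻¹)⁻¹ * (ε⁻¹ * x + (ε + 4 * s)⁻¹ * (2 * t - x)))
        ((ε⁻¹ + (ε + 4 * s)⁻¹)⁻¹) y := by
  have hd : (0:ℝ) < (ε⁻¹ + (ε + 4 * s)⁻¹)⁻¹ := by positivity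
  have he : (0:ℝ) < ε / 2 + s := by positivity
  have h4 : (0:ℝ) < ε + 4 * s := by positivity
  have key : ∀ r : ℝ, g1 x (ε / 2) r * g1 y (ε / 2) r * g1 t s r =
      ((√(2 * Real.pi))⁻¹ ^ 3 * (√(ε / 2))⁻¹ ^ 2 * (√s)⁻¹ *
       Real.exp (-(1 / 2) * ((x - y) ^ 2 / ε + (x + y - 2 * t) ^ 2 / (ε + 4 * s)))) *
      Real.exp (-((4 / ε + 1 / s) / 2) * (r - (2 * (x + y) / ε + t / s) / (4 / ε + 1 / s)) ^ 2) := by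
    intro r
    unfold g1
    rw [rpow_neg_half _ hs, rpow_neg_half _ (half_pos hε), rpow_neg_half _ Real.two_pi_pos]
    rw [mul_assoc (_ * _) (Real.exp _) (Real.exp _), ← Real.exp_add]
    rw [show ∀ a b c d e f : ℝ, a * b * Real.exp c * (a * b * Real.exp d) * (a * e * Real.exp f)
      = a ^ 3 * b ^ 2 * e * Real.exp (c + d + f) by intros; rw [Real.exp_add, Real.exp_add]; ring]
    congr 2
    have : ε + 4 * s ≠ 0 := h4.ne'
    have : 4 * s + ε ≠ 0 := by positivity
    field_simp
    ring
  simp_rw [key]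
  rw [integral_const_mul, int_gauss]
  unfold g1
  rw [rpow_neg_half _ he, rpow_neg_half _ hd, rpow_neg_half _ Real.two_pi_pos]
  rw [show ∀ a b c d e : ℝ, a * b * Real.exp c * (a * d * Real.exp e)
      = a ^ 2 * (b * d) * Real.exp (c + e) by intros; rw [Real.exp_add]; ring]
  rw [show ∀ a b c d e : ℝ, a ^ 3 * b ^ 2 * c * Real.exp d * e = a ^ 2 * (a * b ^ 2 * c * e) * Real.exp d by intros; ring]
  congr 1
  · congr 1
    rw [inv_pow, Real.sq_sqrt (by positivity), ← Real.sqrt_inv, ← Real.sqrt_inv, ← Real.sqrt_inv, ← Real.sqrt_inv]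
    rw [← Real.sqrt_mul (by positivity)]
    rw [← Real.sqrt_sq (show 0 ≤ (ε / 2)⁻¹ by positivity)]
    rw [← Real.sqrt_mul (by positivity), ← Real.sqrt_mul (by positivity), ← Real.sqrt_mul (by positivity)]
    congr 1
    have := Real.pi_pos.ne'
    have : 4 * s + ε ≠ 0 := by positivity
    have : ε + 2 * s ≠ 0 := by positivity
    field_simp
    ring
  · congr 1
    have : ε + 2 * s ≠ 0 := by positivity
    have : ε + 4 * s + ε ≠ 0 := by positivity
    have : ε + (ε + 4 * s) ≠ 0 := by positivity
    field_simp
    ring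

lemma gd_prod {m : ℕ} (U : Matrix (Fin m) (Fin m) ℝ) (h1 : U * Uᵀ = 1)
    (d : Fin m → ℝ) (hd : ∀ i, 0 < d i) (t r : Fin m → ℝ) :
    gaussianDensity t (U * diagonal d * Uᵀ) r =
      ∏ i, g1 ((Uᵀ *ᵥ t) i) (d i) ((Uᵀ *ᵥ r) i) := by
  have h2 : Uᵀ * U = 1 := mul_eq_one_comm.mp h1
  have hdet : (U * diagonal d * Uᵀ).det = ∏ i, d i := by
    rw [det_mul_comm, ← mul_assoc, h2, one_mul, det_diagonal]
  have hinv : (U * diagonal d * Uᵀ)⁻¹ = U * diagonal (fun i => (d i)⁻¹) * Uᵀ := by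
    apply inv_eq_right_inv
    calc _ = U * (diagonal d * ((Uᵀ * U) * diagonal (fun i => (d i)⁻¹))) * Uᵀ := by
            simp only [mul_assoc]
      _ = 1 := by
        rw [h2, one_mul, diagonal_mul_diagonal]
        simp [fun i => mul_inv_cancel₀ (hd i).ne', h1]
  unfold gaussianDensity g1
  rw [hdet, hinv, Finset.prod_mul_distrib, Finset.prod_mul_distrib, ← Real.exp_sum,
    Real.finsetProd_rpow _ _ (fun i _ => (hd i).le), ← Finset.mul_sum]
  congr 1
  · congr 1
    rw [Finset.prod_const, ← Real.rpow_natCast, ← Real.rpow_mul (by positivity)]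
    simp; ring_nf
  · congr 2
    rw [← mulVec_mulVec, ← mulVec_mulVec, dotProduct_mulVec, ← mulVec_transpose, mulVec_sub]
    simp [dotProduct, mulVec_diagonal]

lemma int_rot {m : ℕ} (U : Matrix (Fin m) (Fin m) ℝ) (h1 : U * Uᵀ = 1) (f : (Fin m → ℝ) → ℝ) :
    ∫ r, f (Uᵀ *ᵥ r) = ∫ r, f r := by
  have hdet : |(Uᵀ).det| = 1 := by
    have := congrArg det h1
    rw [det_mul, det_transpose, det_one] at this
    rw [det_transpose]
    have h : |U.det| * |U.det| = 1 := by rw [← abs_mul, this, abs_one]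
    nlinarith [abs_nonneg U.det]
  have hne : (Uᵀ).det ≠ 0 := by intro h; simp [h] at hdet
  have hmap := Real.map_matrix_volume_pi_eq_smul_volume_pi hne
  rw [abs_inv, hdet] at hmap
  simp only [inv_one, ENNReal.ofReal_one, one_smul] at hmap
  have hc : Continuous (toLin' Uᵀ) := LinearMap.continuous_of_finiteDimensional _
  have hmp : MeasurePreserving (toLin' Uᵀ) volume volume := ⟨hc.measurable, hmap⟩
  have hinj : Function.Injective (toLin' Uᵀ) := by
    intro a b h
    have := congrArg (fun v => U *ᵥ v) h
    simpa [mulVec_mulVec, h1] using this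
  exact hmp.integral_comp (hc.measurableEmbedding hinj) f

theorem mgc_kernel_closed_form {m n : ℕ} (ε : ℝ) (hε : 0 < ε)
    (a : Fin n → ℝ) (θ : Fin n → Fin m → ℝ)
    (S : Fin n → Matrix (Fin m) (Fin m) ℝ)
    (hS : ∀ j, (S j).PosDef) (ha : ∀ j, 0 ≤ a j) (hsum : ∑ j, a j = 1)
    (x y : Fin m → ℝ) :
    mgcKernel ε a θ S x y =
      ∑ j, a j *
        gaussianDensity (θ j)
          ((ε / 2) • (1 : Matrix (Fin m) (Fin m) ℝ) + S j) x *
        gaussianDensity (cvec ε (S j) (θ j) x) (Dmat ε (S j)) y := by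
  have main : ∀ j, (∫ r, gaussianDensity x ((ε / 2) • (1 : Matrix (Fin m) (Fin m) ℝ)) r *
      gaussianDensity y ((ε / 2) • (1 : Matrix (Fin m) (Fin m) ℝ)) r *
      gaussianDensity (θ j) (S j) r) = gaussianDensity (θ j)
          ((ε / 2) • (1 : Matrix (Fin m) (Fin m) ℝ) + S j) x *
        gaussianDensity (cvec ε (S j) (θ j) x) (Dmat ε (S j)) y ∧
      0 < gaussianDensity (θ j)
          ((ε / 2) • (1 : Matrix (Fin m) (Fin m) ℝ) + S j) x *
        gaussianDensity (cvec ε (S j) (θ j) x) (Dmat ε (S j)) y := by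
    intro j
    obtain ⟨U, d, h1, hd, hSj⟩ : ∃ (U : Matrix (Fin m) (Fin m) ℝ) (d : Fin m → ℝ),
        U * Uᵀ = 1 ∧ (∀ i, 0 < d i) ∧ S j = U * diagonal d * Uᵀ := by
      refine ⟨(hS j).1.eigenvectorUnitary, (hS j).1.eigenvalues, ?_, (hS j).eigenvalues_pos, ?_⟩
      · have := (Unitary.mem_iff.mp (hS j).1.eigenvectorUnitary.2).2
        simpa [star_eq_conjTranspose] using this
      · have := (hS j).1.spectral_theorem
        simpa [Unitary.conjStarAlgAut_apply, star_eq_conjTranspose, Function.comp_def] using this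
    have h2 : Uᵀ * U = 1 := mul_eq_one_comm.mp h1
    have hsc : ∀ c : ℝ, c • (1 : Matrix (Fin m) (Fin m) ℝ) = U * diagonal (fun _ => c) * Uᵀ := by
      intro c
      rw [show diagonal (fun _ : Fin m => c) = c • (1 : Matrix (Fin m) (Fin m) ℝ) by
        rw [smul_one_eq_diagonal]]
      simp [h1]
    have hadd : ∀ d e : Fin m → ℝ, U * diagonal d * Uᵀ + U * diagonal e * Uᵀ =
        U * diagonal (fun i => d i + e i) * Uᵀ := by
      intro d e
      rw [← diagonal_add, mul_add, add_mul]
    have hinv : ∀ d : Fin m → ℝ, (∀ i, 0 < d i) → (U * diagonal d * Uᵀ)⁻¹ =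
        U * diagonal (fun i => (d i)⁻¹) * Uᵀ := by
      intro d hd
      apply inv_eq_right_inv
      calc _ = U * (diagonal d * ((Uᵀ * U) * diagonal (fun i => (d i)⁻¹))) * Uᵀ := by
              simp only [mul_assoc]
        _ = 1 := by
          rw [h2, one_mul, diagonal_mul_diagonal]
          simp [fun i => mul_inv_cancel₀ (hd i).ne', h1]
    have h4S : ε • (1 : Matrix (Fin m) (Fin m) ℝ) + (4 : ℝ) • S j =
        U * diagonal (fun i => ε + 4 * d i) * Uᵀ := by
      rw [hsc, hSj, ← hadd, ← smul_mul_assoc, ← mul_smul_comm, ← diagonal_smul]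
      rfl
    have hp4 : ∀ i, 0 < ε + 4 * d i := fun i => by have := hd i; positivity
    have hpD : ∀ i, 0 < ε⁻¹ + (ε + 4 * d i)⁻¹ := fun i => by have := hp4 i; positivity
    have hD : Dmat ε (S j) = U * diagonal (fun i => (ε⁻¹ + (ε + 4 * d i)⁻¹)⁻¹) * Uᵀ := by
      unfold Dmat
      rw [h4S, hinv _ hp4, hsc, hadd, hinv _ hpD]
    have hc : ∀ i, (Uᵀ *ᵥ cvec ε (S j) (θ j) x) i = (ε⁻¹ + (ε + 4 * d i)⁻¹)⁻¹ *
        (ε⁻¹ * (Uᵀ *ᵥ x) i + (ε + 4 * d i)⁻¹ * (2 * (Uᵀ *ᵥ θ j) i - (Uᵀ *ᵥ x) i)) := by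
      intro i
      unfold cvec
      rw [hD, h4S, hinv _ hp4, mulVec_mulVec, ← mul_assoc, ← mul_assoc, h2, one_mul,
        ← mulVec_mulVec, mulVec_diagonal, mulVec_add, mulVec_mulVec, ← mul_assoc, ← mul_assoc, h2,
        one_mul, ← mulVec_mulVec, Pi.add_apply, mulVec_diagonal, mulVec_sub, mulVec_smul,
        mulVec_smul]
      simp
    have hps : ∀ i, 0 < ε / 2 + d i := fun i => by have := hd i; positivity
    rw [hD, hsc, hSj, hadd]
    rw [gd_prod U h1 _ hps, gd_prod U h1 _ (fun i => inv_pos.mpr (hpD i))]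
    constructor
    · simp_rw [gd_prod U h1 _ hd, gd_prod U h1 (fun _ => ε / 2) (fun _ => half_pos hε)]
      rw [int_rot U h1 (fun r => (∏ i, g1 ((Uᵀ *ᵥ x) i) (ε / 2) (r i)) *
        (∏ i, g1 ((Uᵀ *ᵥ y) i) (ε / 2) (r i)) * ∏ i, g1 ((Uᵀ *ᵥ θ j) i) (d i) (r i))]
      simp_rw [← Finset.prod_mul_distrib]
      rw [integral_fintype_prod_volume_eq_prod (fun i r => g1 ((Uᵀ *ᵥ x) i) (ε / 2) r *
        g1 ((Uᵀ *ᵥ y) i) (ε / 2) r * g1 ((Uᵀ *ᵥ θ j) i) (d i) r)]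
      refine Finset.prod_congr rfl fun i _ => ?_
      rw [← hSj, hc, one_dim _ _ _ _ _ hε (hd i)]
    · exact mul_pos (Finset.prod_pos fun i _ => g1_pos _ _ _ (hps i))
        (Finset.prod_pos fun i _ => g1_pos _ _ _ (inv_pos.mpr (hpD i)))
  unfold mgcKernel
  simp_rw [Finset.mul_sum, mul_left_comm _ (a _) _]
  rw [integral_finsetSum]
  · refine Finset.sum_congr rfl fun j _ => ?_
    rw [integral_const_mul, (main j).1, mul_assoc]
  · intro j _
    refine Integrable.const_mul (Integrable.of_integral_ne_zero ?_) _
    rw [(main j).1]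
    exact (main j).2.ne'
end

section
/- Under the Gaussian mixture model, the inner product W_{x,z} = ⟨k_ε(x,·), k_ε(z,·)⟩_{L²(ℝ^m)} has the closed form W_{x,z} = Σ_{j,i=1}^n a_j a_i g(x; θ_j, (ε/2)I + Σ_j) g(z; θ_i, (ε/2)I + Σ_i) g(c_j(x); c_i(z), D_j + D_i), with D_j = (ε⁻¹I + (εI + 4Σ_j)⁻¹)⁻¹ and c_j(x) = D_j(ε⁻¹x + (εI + 4Σ_j)⁻¹(2θ_j − x)). -/
open Matrix MeasureTheory

lemma mgc_symm_dot {m : ℕ} {P : Matrix (Fin m) (Fin m) ℝ} (hP : P.IsHermitian)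
    (v w : Fin m → ℝ) : v ⬝ᵥ (P *ᵥ w) = w ⬝ᵥ (P *ᵥ v) := by
  have h : Pᵀ = P := by simpa [Matrix.IsHermitian] using hP
  rw [Matrix.dotProduct_mulVec, dotProduct_comm, ← Matrix.mulVec_transpose, h]

lemma mgc_quad {m : ℕ} {P Q : Matrix (Fin m) (Fin m) ℝ} (hP : P.IsHermitian)
    (hQ : Q.IsHermitian) (w d t : Fin m → ℝ) (ht : (P + Q) *ᵥ t = Q *ᵥ d) :
    w ⬝ᵥ (P *ᵥ w) + (w - d) ⬝ᵥ (Q *ᵥ (w - d)) =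
      d ⬝ᵥ (Q *ᵥ d - Q *ᵥ t) + (w - t) ⬝ᵥ ((P + Q) *ᵥ (w - t)) := by
  have h1 : w ⬝ᵥ ((P + Q) *ᵥ t) = w ⬝ᵥ (Q *ᵥ d) := by rw [ht]
  have h2 : t ⬝ᵥ ((P + Q) *ᵥ t) = t ⬝ᵥ (Q *ᵥ d) := by rw [ht]
  have h3 := mgc_symm_dot hQ t d
  have h4 := mgc_symm_dot hQ d w
  have h5 := mgc_symm_dot hQ t w
  have h6 := mgc_symm_dot hP t w
  simp only [Matrix.add_mulVec, Matrix.mulVec_sub, dotProduct_sub, sub_dotProduct,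
    dotProduct_add] at *
  linarith

lemma mgc_unit {m : ℕ} {A : Matrix (Fin m) (Fin m) ℝ} (hA : A.PosDef) : IsUnit A.det :=
  isUnit_iff_ne_zero.mpr hA.det_pos.ne'

lemma mgc_inv_add {m : ℕ} {A B : Matrix (Fin m) (Fin m) ℝ} (hA : A.PosDef) (hB : B.PosDef) :
    (A + B)⁻¹ = B⁻¹ - B⁻¹ * ((A⁻¹ + B⁻¹)⁻¹ * B⁻¹) := by
  have uA := mgc_unit hA
  have uB := mgc_unit hB
  have uH := mgc_unit (hA.inv.add hB.inv)
  apply Matrix.inv_eq_right_inv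
  have e1 : (A + B) * B⁻¹ = A * (A⁻¹ + B⁻¹) := by
    rw [add_mul, mul_add, Matrix.mul_nonsing_inv _ uA, Matrix.mul_nonsing_inv _ uB, add_comm]
  rw [mul_sub, ← mul_assoc (A + B), e1, mul_assoc A, ← mul_assoc (A⁻¹ + B⁻¹),
    Matrix.mul_nonsing_inv _ uH, one_mul, mul_add, Matrix.mul_nonsing_inv _ uA]
  simp

lemma mgc_det {m : ℕ} {A B : Matrix (Fin m) (Fin m) ℝ} (hA : A.PosDef) (hB : B.PosDef) :
    A.det * B.det = (A + B).det * ((A⁻¹ + B⁻¹)⁻¹).det := by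
  have uA := mgc_unit hA
  have uB := mgc_unit hB
  have uH := mgc_unit (hA.inv.add hB.inv)
  have e : A * (A⁻¹ + B⁻¹) * B = A + B := by
    rw [mul_add, add_mul, Matrix.mul_nonsing_inv _ uA, mul_assoc, Matrix.nonsing_inv_mul _ uB]
    simp [add_comm]
  rw [← e, Matrix.det_mul, Matrix.det_mul, Matrix.det_nonsing_inv (A⁻¹ + B⁻¹), Ring.inverse_eq_inv']
  have := uH.ne_zero
  field_simp

lemma mgc_prod {m : ℕ} {A B : Matrix (Fin m) (Fin m) ℝ} (hA : A.PosDef) (hB : B.PosDef)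
    (u v r : Fin m → ℝ) :
    gaussianDensity u A r * gaussianDensity v B r =
      gaussianDensity v (A + B) u *
        gaussianDensity ((A⁻¹ + B⁻¹)⁻¹ *ᵥ (A⁻¹ *ᵥ u + B⁻¹ *ᵥ v)) ((A⁻¹ + B⁻¹)⁻¹) r := by
  have hH := hA.inv.add hB.inv
  have uH := mgc_unit hH
  have hq := mgc_quad hA.inv.isHermitian hB.inv.isHermitian (r - u) (v - u)
    ((A⁻¹ + B⁻¹)⁻¹ *ᵥ (A⁻¹ *ᵥ u + B⁻¹ *ᵥ v) - u) (by
      rw [Matrix.mulVec_sub, Matrix.mulVec_mulVec, Matrix.mul_nonsing_inv _ uH]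
      simp [Matrix.add_mulVec, Matrix.mulVec_sub])
  have ht : (A⁻¹ + B⁻¹)⁻¹ *ᵥ (A⁻¹ *ᵥ u + B⁻¹ *ᵥ v) - u = (A⁻¹ + B⁻¹)⁻¹ *ᵥ (B⁻¹ *ᵥ (v - u)) := by
    have : u = (A⁻¹ + B⁻¹)⁻¹ *ᵥ ((A⁻¹ + B⁻¹) *ᵥ u) := by
      rw [Matrix.mulVec_mulVec, Matrix.nonsing_inv_mul _ uH, Matrix.one_mulVec]
    refine (congrArg (fun s => (A⁻¹ + B⁻¹)⁻¹ *ᵥ (A⁻¹ *ᵥ u + B⁻¹ *ᵥ v) - s) this).trans ?_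
    rw [← Matrix.mulVec_sub]
    congr 1
    simp [Matrix.add_mulVec, Matrix.mulVec_sub]
  have hM : (u - v) ⬝ᵥ ((A + B)⁻¹ *ᵥ (u - v)) = (v - u) ⬝ᵥ (B⁻¹ *ᵥ (v - u) -
      B⁻¹ *ᵥ ((A⁻¹ + B⁻¹)⁻¹ *ᵥ (A⁻¹ *ᵥ u + B⁻¹ *ᵥ v) - u)) := by
    rw [ht, mgc_inv_add hA hB, ← neg_sub v u, Matrix.mulVec_neg, neg_dotProduct_neg,
      Matrix.sub_mulVec, Matrix.mulVec_mulVec, Matrix.mulVec_mulVec, mul_assoc]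
  rw [← hM] at hq
  have e1 : r - u - (v - u) = r - v := by abel
  have e2 : r - u - ((A⁻¹ + B⁻¹)⁻¹ *ᵥ (A⁻¹ *ᵥ u + B⁻¹ *ᵥ v) - u) =
    r - (A⁻¹ + B⁻¹)⁻¹ *ᵥ (A⁻¹ *ᵥ u + B⁻¹ *ᵥ v) := by abel
  rw [e1, e2] at hq
  have hd : A.det ^ (-(1:ℝ)/2) * B.det ^ (-(1:ℝ)/2) =
      (A + B).det ^ (-(1:ℝ)/2) * ((A⁻¹ + B⁻¹)⁻¹).det ^ (-(1:ℝ)/2) := by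
    rw [← Real.mul_rpow hA.det_pos.le hB.det_pos.le, mgc_det hA hB,
      Real.mul_rpow (hA.add hB).det_pos.le hH.inv.det_pos.le]
  unfold gaussianDensity
  rw [Matrix.nonsing_inv_nonsing_inv _ uH]
  generalize (2 * Real.pi) ^ (-(m : ℝ) / 2) = K
  have he := congrArg (fun s : ℝ => Real.exp (-(1/2) * s)) hq
  simp only [mul_add, Real.exp_add] at he
  calc _ = K * K * (A.det ^ (-(1:ℝ)/2) * B.det ^ (-(1:ℝ)/2)) *
        (Real.exp (-(1 / 2) * ((r - u) ⬝ᵥ (A⁻¹ *ᵥ (r - u)))) *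
          Real.exp (-(1 / 2) * ((r - v) ⬝ᵥ (B⁻¹ *ᵥ (r - v))))) := by ring
    _ = _ := by rw [hd, he]; ring

open scoped MatrixOrder in
lemma mgc_sqrt {m : ℕ} {A : Matrix (Fin m) (Fin m) ℝ} (hA : A.PosDef) :
    ∃ L : Matrix (Fin m) (Fin m) ℝ, A = L * Lᵀ := by
  obtain ⟨B, hB⟩ := CStarAlgebra.nonneg_iff_eq_star_mul_self.mp hA.posSemidef.nonneg
  refine ⟨Bᵀ, ?_⟩
  rw [hB, Matrix.transpose_transpose, Matrix.star_eq_conjTranspose,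
    Matrix.conjTranspose_eq_transpose_of_trivial]

lemma mgc_std (m : ℕ) :
    ∫ w : Fin m → ℝ, Real.exp (-(1 / 2) * (w ⬝ᵥ w)) = (2 * Real.pi) ^ ((m : ℝ) / 2) := by
  have h : ∀ w : Fin m → ℝ, Real.exp (-(1 / 2) * (w ⬝ᵥ w)) =
      ∏ i, Real.exp (-(1 / 2) * (w i) ^ 2) := by
    intro w
    rw [← Real.exp_sum, dotProduct, Finset.mul_sum]
    simp [sq]
  simp_rw [h]
  rw [integral_fintype_prod_volume_eq_pow (fun s : ℝ => Real.exp (-(1 / 2) * s ^ 2)),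
    integral_gaussian, Real.sqrt_eq_rpow, ← Real.rpow_natCast, ← Real.rpow_mul (by positivity)]
  simp only [Fintype.card_fin]
  congr 1 <;> ring

lemma mgc_integral_one {m : ℕ} {A : Matrix (Fin m) (Fin m) ℝ} (hA : A.PosDef)
    (u : Fin m → ℝ) : ∫ r, gaussianDensity u A r = 1 := by
  obtain ⟨L, hL⟩ := mgc_sqrt hA
  have hdet : A.det = L.det ^ 2 := by rw [hL, Matrix.det_mul, Matrix.det_transpose, sq]
  have hL0 : L.det ≠ 0 := by
    intro h
    have := hA.det_pos
    simp [hdet, h] at this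
  have uL : IsUnit L.det := isUnit_iff_ne_zero.mpr hL0
  have uLt : IsUnit Lᵀ.det := by rwa [Matrix.det_transpose]
  have hq : ∀ w, (L *ᵥ w) ⬝ᵥ (A⁻¹ *ᵥ (L *ᵥ w)) = w ⬝ᵥ w := by
    intro w
    have e : A⁻¹ *ᵥ (L *ᵥ w) = (Lᵀ)⁻¹ *ᵥ w := by
      rw [hL, Matrix.mul_inv_rev, Matrix.mulVec_mulVec, mul_assoc, Matrix.nonsing_inv_mul _ uL,
        mul_one]
    rw [e, dotProduct_comm, Matrix.dotProduct_mulVec, ← Matrix.mulVec_transpose,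
      Matrix.mulVec_mulVec, Matrix.mul_nonsing_inv _ uLt, Matrix.one_mulVec]
  have hcont : Continuous fun r : Fin m → ℝ => Real.exp (-(1 / 2) * (r ⬝ᵥ (A⁻¹ *ᵥ r))) := by
    fun_prop
  have hLc : Continuous (Matrix.toLin' L) := LinearMap.continuous_of_finiteDimensional _
  have key : ∫ w, Real.exp (-(1 / 2) * ((Matrix.toLin' L w) ⬝ᵥ (A⁻¹ *ᵥ (Matrix.toLin' L w)))) =
      |L.det|⁻¹ * ∫ r : Fin m → ℝ, Real.exp (-(1 / 2) * (r ⬝ᵥ (A⁻¹ *ᵥ r))) := by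
    rw [← integral_map (φ := Matrix.toLin' L)
      (f := fun r : Fin m → ℝ => Real.exp (-(1 / 2) * (r ⬝ᵥ (A⁻¹ *ᵥ r))))
      hLc.aemeasurable hcont.aestronglyMeasurable,
      Real.map_matrix_volume_pi_eq_smul_volume_pi hL0, integral_smul_measure,
      ENNReal.toReal_ofReal (abs_nonneg _), abs_inv, smul_eq_mul]
  simp only [Matrix.toLin'_apply, hq, mgc_std] at key
  have hs : A.det ^ (-(1:ℝ)/2) = |L.det|⁻¹ := by
    rw [hdet, ← sq_abs, ← Real.rpow_natCast, ← Real.rpow_mul (abs_nonneg _)]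
    norm_num
    exact Real.rpow_neg_one _
  unfold gaussianDensity
  rw [integral_const_mul, integral_sub_right_eq_self
    (fun r : Fin m → ℝ => Real.exp (-(1 / 2) * (r ⬝ᵥ (A⁻¹ *ᵥ r)))) u, hs, mul_assoc, ← key,
    ← Real.rpow_add (by positivity)]
  rw [neg_div, neg_add_cancel, Real.rpow_zero]

lemma mgc_integrable {m : ℕ} {A : Matrix (Fin m) (Fin m) ℝ} (hA : A.PosDef)
    (u : Fin m → ℝ) : Integrable (gaussianDensity u A) :=
  integrable_of_integral_eq_one (mgc_integral_one hA u)

lemma mgc_prod_integrable {m : ℕ} {A B : Matrix (Fin m) (Fin m) ℝ} (hA : A.PosDef)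
    (hB : B.PosDef) (u v : Fin m → ℝ) :
    Integrable fun r => gaussianDensity u A r * gaussianDensity v B r := by
  simp_rw [mgc_prod hA hB]
  exact (mgc_integrable (hA.inv.add hB.inv).inv _).const_mul _

lemma mgc_prod_integral {m : ℕ} {A B : Matrix (Fin m) (Fin m) ℝ} (hA : A.PosDef)
    (hB : B.PosDef) (u v : Fin m → ℝ) :
    ∫ r, gaussianDensity u A r * gaussianDensity v B r = gaussianDensity v (A + B) u := by
  simp_rw [mgc_prod hA hB]
  rw [integral_const_mul, mgc_integral_one (hA.inv.add hB.inv).inv, mul_one]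

lemma mgc_scale {m : ℕ} {A : Matrix (Fin m) (Fin m) ℝ} (hA : A.PosDef)
    (u v u' v' : Fin m → ℝ) (h : u' - v' = (2 : ℝ) • (u - v)) :
    gaussianDensity v A u = 2 ^ m * gaussianDensity v' ((4 : ℝ) • A) u' := by
  have hi : ((4 : ℝ) • A)⁻¹ = (4 : ℝ)⁻¹ • A⁻¹ := by
    apply Matrix.inv_eq_right_inv
    simp [Matrix.mul_nonsing_inv _ (mgc_unit hA), smul_smul]
  have hd : ((4 : ℝ) • A).det ^ (-(1:ℝ)/2) = (2 ^ m)⁻¹ * A.det ^ (-(1:ℝ)/2) := by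
    rw [Matrix.det_smul, Fintype.card_fin, Real.mul_rpow (by positivity) hA.det_pos.le]
    congr 1
    rw [show (4:ℝ) = 2 ^ 2 by norm_num, ← pow_mul, mul_comm, pow_mul, ← Real.rpow_natCast,
      ← Real.rpow_mul (by positivity)]
    norm_num
    exact Real.rpow_neg_one _
  unfold gaussianDensity
  rw [hi, hd, h]
  simp only [Matrix.smul_mulVec, Matrix.mulVec_smul, dotProduct_smul, smul_dotProduct, smul_eq_mul]
  rw [show 2 * ((4:ℝ)⁻¹ * (2 * ((u - v) ⬝ᵥ A⁻¹ *ᵥ (u - v)))) = (u - v) ⬝ᵥ A⁻¹ *ᵥ (u - v) by ring]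
  field_simp

lemma mgc_inv_smul_one {m : ℕ} {c : ℝ} (hc : c ≠ 0) :
    (c • (1 : Matrix (Fin m) (Fin m) ℝ))⁻¹ = c⁻¹ • 1 := by
  apply Matrix.inv_eq_right_inv
  simp [smul_smul, hc]

lemma mgc_comm {m : ℕ} (A : Matrix (Fin m) (Fin m) ℝ) (u v : Fin m → ℝ) :
    gaussianDensity u A v = gaussianDensity v A u := by
  unfold gaussianDensity
  rw [← neg_sub u v, Matrix.mulVec_neg, neg_dotProduct_neg]

lemma mgc_pd_one {m : ℕ} {c : ℝ} (hc : 0 < c) :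
    (c • (1 : Matrix (Fin m) (Fin m) ℝ)).PosDef := Matrix.PosDef.one.smul hc

lemma mgc_pd_D {m : ℕ} {ε : ℝ} (hε : 0 < ε) {S : Matrix (Fin m) (Fin m) ℝ} (hS : S.PosDef) :
    (Dmat ε S).PosDef :=
  ((mgc_pd_one (inv_pos.mpr hε)).add
    ((mgc_pd_one hε).add (hS.smul (by norm_num : (0:ℝ) < 4))).inv).inv

lemma mgc_pair {m : ℕ} {ε : ℝ} (hε : 0 < ε) (x y r : Fin m → ℝ) :
    gaussianDensity x ((ε / 2) • (1 : Matrix (Fin m) (Fin m) ℝ)) r *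
      gaussianDensity y ((ε / 2) • (1 : Matrix (Fin m) (Fin m) ℝ)) r =
    gaussianDensity y (ε • (1 : Matrix (Fin m) (Fin m) ℝ)) x *
      gaussianDensity ((2⁻¹ : ℝ) • (x + y)) ((ε / 4) • (1 : Matrix (Fin m) (Fin m) ℝ)) r := by
  have h2 : (0:ℝ) < ε / 2 := by positivity
  have e : ((ε / 2)⁻¹ + (ε / 2)⁻¹)⁻¹ = ε / 4 := by field_simp; norm_num
  rw [mgc_prod (mgc_pd_one h2) (mgc_pd_one h2), mgc_inv_smul_one h2.ne', ← add_smul, ← add_smul,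
    mgc_inv_smul_one (by positivity), e, add_halves, ← Matrix.mulVec_add]
  simp only [Matrix.smul_mulVec, Matrix.one_mulVec, smul_smul]
  rw [show ε / 4 * (ε / 2)⁻¹ = 2⁻¹ by field_simp; norm_num]

lemma mgc_component {m : ℕ} {ε : ℝ} (hε : 0 < ε) {S : Matrix (Fin m) (Fin m) ℝ}
    (hS : S.PosDef) (θ x y : Fin m → ℝ) :
    ∫ r, gaussianDensity x ((ε / 2) • (1 : Matrix (Fin m) (Fin m) ℝ)) r *
      gaussianDensity y ((ε / 2) • (1 : Matrix (Fin m) (Fin m) ℝ)) r * gaussianDensity θ S r =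
    gaussianDensity θ ((ε / 2) • (1 : Matrix (Fin m) (Fin m) ℝ) + S) x *
      gaussianDensity (cvec ε S θ x) (Dmat ε S) y := by
  have p4 : ((ε / 4) • (1 : Matrix (Fin m) (Fin m) ℝ)).PosDef := mgc_pd_one (by positivity)
  have p2 : ((ε / 2) • (1 : Matrix (Fin m) (Fin m) ℝ)).PosDef := mgc_pd_one (by positivity)
  have p1 : (ε • (1 : Matrix (Fin m) (Fin m) ℝ)).PosDef := mgc_pd_one hε
  have pS : (ε • (1 : Matrix (Fin m) (Fin m) ℝ) + (4:ℝ) • S).PosDef :=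
    p1.add (hS.smul (by norm_num))
  simp_rw [mgc_pair hε, mul_assoc]
  rw [integral_const_mul, mgc_prod_integral p4 hS,
    mgc_scale (p4.add hS) _ _ y ((2:ℝ) • θ - x) (by
      ext i; simp; ring),
    mgc_scale (p2.add hS) _ _ x ((2:ℝ) • θ - x) (by
      ext i; simp; ring)]
  have e4 : (4:ℝ) • ((ε / 4) • (1 : Matrix (Fin m) (Fin m) ℝ) + S) = ε • 1 + (4:ℝ) • S := by
    rw [smul_add, smul_smul]; congr 2; ring
  have e2 : (4:ℝ) • ((ε / 2) • (1 : Matrix (Fin m) (Fin m) ℝ) + S) =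
      ε • 1 + (ε • 1 + (4:ℝ) • S) := by
    rw [smul_add, smul_smul, ← add_assoc, ← add_smul]; congr 2; ring
  have hp := mgc_prod p1 pS x ((2:ℝ) • θ - x) y
  rw [mgc_inv_smul_one hε.ne', Matrix.smul_mulVec, Matrix.one_mulVec] at hp
  change _ = _ * gaussianDensity (cvec ε S θ x) (Dmat ε S) y at hp
  rw [e4, e2, mgc_comm _ y x, mul_assoc, ← hp]
  ring

lemma mgc_kernel {m n : ℕ} {ε : ℝ} (hε : 0 < ε)
    (a : Fin n → ℝ) (θ : Fin n → Fin m → ℝ)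
    (S : Fin n → Matrix (Fin m) (Fin m) ℝ) (hS : ∀ j, (S j).PosDef) (x y : Fin m → ℝ) :
    mgcKernel ε a θ S x y = ∑ j, a j *
      gaussianDensity (θ j) ((ε / 2) • (1 : Matrix (Fin m) (Fin m) ℝ) + S j) x *
      gaussianDensity (cvec ε (S j) (θ j) x) (Dmat ε (S j)) y := by
  unfold mgcKernel
  simp_rw [Finset.mul_sum, mul_left_comm _ (a _) _]
  rw [integral_finsetSum]
  · refine Finset.sum_congr rfl fun j _ => ?_
    rw [integral_const_mul, mgc_component hε (hS j), mul_assoc]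
  · intro j _
    apply Integrable.const_mul
    simp_rw [mgc_pair hε, mul_assoc]
    exact (mgc_prod_integrable (mgc_pd_one (by positivity)) (hS j) _ _).const_mul _

theorem mgc_inner_product_closed_form {m n : ℕ} (ε : ℝ) (hε : 0 < ε)
    (a : Fin n → ℝ) (θ : Fin n → Fin m → ℝ)
    (S : Fin n → Matrix (Fin m) (Fin m) ℝ)
    (hS : ∀ j, (S j).PosDef) (ha : ∀ j, 0 ≤ a j) (hsum : ∑ j, a j = 1)
    (x z : Fin m → ℝ) :
    ∫ y : Fin m → ℝ, mgcKernel ε a θ S x y * mgcKernel ε a θ S z y =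
      ∑ j, ∑ i, a j * a i *
        gaussianDensity (θ j)
          ((ε / 2) • (1 : Matrix (Fin m) (Fin m) ℝ) + S j) x *
        gaussianDensity (θ i)
          ((ε / 2) • (1 : Matrix (Fin m) (Fin m) ℝ) + S i) z *
        gaussianDensity (cvec ε (S i) (θ i) z) (Dmat ε (S j) + Dmat ε (S i))
          (cvec ε (S j) (θ j) x) := by
  simp_rw [mgc_kernel hε a θ S hS, Finset.sum_mul_sum]
  have hi : ∀ i j : Fin n, ∀ α β : ℝ, Integrable fun y =>
      α * gaussianDensity (cvec ε (S j) (θ j) x) (Dmat ε (S j)) y *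
      (β * gaussianDensity (cvec ε (S i) (θ i) z) (Dmat ε (S i)) y) := by
    intro i j α β
    simp_rw [mul_mul_mul_comm α]
    exact (mgc_prod_integrable (mgc_pd_D hε (hS j)) (mgc_pd_D hε (hS i)) _ _).const_mul _
  rw [integral_finsetSum _ fun j _ => integrable_finsetSum _ fun i _ => hi i j _ _]
  refine Finset.sum_congr rfl fun j _ => ?_
  rw [integral_finsetSum _ fun i _ => hi i j _ _]
  refine Finset.sum_congr rfl fun i _ => ?_
  rw [← mgc_prod_integral (mgc_pd_D hε (hS j)) (mgc_pd_D hε (hS i)), ← integral_const_mul]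
  congr 1
  ext y
  ring
end
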